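/- Let d ≥ 1 be an integer, let λ > 1 be a real, and set ν = λ^{1/(d+1)}. Then for all naturals x, m, z with z ≤ x and (x+1)^{d+1} ≤ ν·(x^{d+1} − (x+1)^d + x^d), it holds that λ·Σ_{i=z+1}^{m+z} i^d − m·ν·(x+1)^d + (x−z)·ν·x^d ≥ Σ_{i=z+1}^{x} i^d. (In the paper this is stated as: for d ≤ 5 and x ≥ 150, the function f'(n) = ν·n^d with ν = λ_d^{1/(d+1)} is strongly (λ_d, 0)-smooth with respect to the potential function for the appropriate constant λ_d = ρ_d; the displayed inequality is exactly the condition established in its proof, with n = x − z.) -/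

import Mathlib

open Finset Real

/-- Power sum `1^d + ... + n^d`. -/
noncomputable def powSum (d n : ℕ) : ℝ := ∑ i ∈ Finset.range n, ((i : ℝ) + 1) ^ d

lemma powSum_succ (d n : ℕ) : powSum d (n + 1) = powSum d n + ((n : ℝ) + 1) ^ d := by
  simp [powSum, Finset.sum_range_succ]

lemma powSum_zero (d : ℕ) : powSum d 0 = 0 := by simp [powSum]

lemma sum_Icc_eq (d z n : ℕ) :
    ∑ i ∈ Finset.Icc (z + 1) (n + z), (i : ℝ) ^ d = powSum d (n + z) - powSum d z := by
  induction n with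
  | zero => simp
  | succ n ih =>
    have h : n + 1 + z = n + z + 1 := by ring
    rw [h, Finset.sum_Icc_succ_top (by omega), ih, powSum_succ]
    push_cast
    ring

lemma young (d : ℕ) (t a : ℝ) (ht : 0 ≤ t) (ha : 0 ≤ a) :
    ((d : ℝ) + 1) * t * a ^ d ≤ t ^ (d + 1) + d * a ^ (d + 1) := by
  induction d with
  | zero => simp
  | succ d ih =>
    have h1 := mul_le_mul_of_nonneg_left ih ht
    have h2 : 0 ≤ ((d : ℝ) + 1) * a ^ d * (t - a) ^ 2 := by positivity
    push_cast
    simp only [pow_succ] at *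
    nlinarith

lemma powSum_lower (d n : ℕ) : (n : ℝ) ^ (d + 1) ≤ ((d : ℝ) + 1) * powSum d n := by
  induction n with
  | zero => simp [powSum_zero]
  | succ n ih =>
    have h := young d n ((n : ℝ) + 1) (by positivity) (by positivity)
    rw [powSum_succ]
    push_cast
    simp only [pow_succ] at *
    nlinarith

lemma powSum_upper (d n : ℕ) : ((d : ℝ) + 1) * powSum d n ≤ ((n : ℝ) + 1) ^ (d + 1) := by
  induction n with
  | zero => simp [powSum_zero]
  | succ n ih =>
    have h := young d ((n : ℝ) + 2) ((n : ℝ) + 1) (by positivity) (by positivity)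
    have e : ((n : ℝ) + 1 + 1) = (n : ℝ) + 2 := by ring
    rw [powSum_succ]
    push_cast
    rw [e]
    simp only [pow_succ] at *
    nlinarith

lemma powSum_diff_lower (d a k : ℕ) :
    (k : ℝ) * ((a : ℝ) + 1) ^ d ≤ powSum d (k + a) - powSum d a := by
  induction k with
  | zero => simp
  | succ k ih =>
    have h : k + 1 + a = k + a + 1 := by ring
    have h2 : ((a : ℝ) + 1) ^ d ≤ (((k + a : ℕ) : ℝ) + 1) ^ d := by
      gcongr
      exact_mod_cast Nat.le_add_left a k
    rw [h, powSum_succ]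
    push_cast at *
    linarith

lemma powSum_diff_upper (d a k : ℕ) :
    powSum d (k + a) - powSum d a ≤ (k : ℝ) * ((k : ℝ) + a) ^ d := by
  induction k with
  | zero => simp
  | succ k ih =>
    have h : k + 1 + a = k + a + 1 := by ring
    have h2 : ((k : ℝ) + a) ^ d ≤ ((k : ℝ) + 1 + a) ^ d := by
      gcongr
      linarith
    have h3 := mul_le_mul_of_nonneg_left h2 (Nat.cast_nonneg (α := ℝ) k)
    have e : (k : ℝ) + a + 1 = (k : ℝ) + 1 + a := by ring
    rw [h, powSum_succ]
    push_cast at *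
    rw [e]
    linarith

lemma powSum_avg (d z k : ℕ) :
    powSum d z * ((k : ℝ) + z) ≤ z * powSum d (k + z) := by
  have h1 := powSum_diff_lower d z k
  have h2 := powSum_diff_upper d 0 z
  simp only [powSum_zero, Nat.cast_zero, add_zero, sub_zero] at h2
  have h3 : (z : ℝ) ^ d ≤ ((z : ℝ) + 1) ^ d := by
    gcongr
    linarith
  have hk : (0 : ℝ) ≤ k := Nat.cast_nonneg k
  have hz : (0 : ℝ) ≤ z := Nat.cast_nonneg z
  have h4 := mul_le_mul_of_nonneg_left h2 hk
  have h5 := mul_le_mul_of_nonneg_left h3 (mul_nonneg hk hz)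
  have h6 := mul_le_mul_of_nonneg_left h1 hz
  nlinarith

/-- For `d ≥ 1`, `lam > 1` and `ν = lam^(1/(d+1))`, the modified cost function
`f'(n) = ν * n^d` satisfies the per-resource strong `(lam, 0)`-smoothness condition with respect
to Rosenthal's potential of the resource cost `f(n) = n^d`, for all loads `x` large enough that
`(x+1)^(d+1) ≤ ν * (x^(d+1) - (x+1)^d + x^d)`. -/
theorem smoothness_large_load_potential
    (d : ℕ) (hd : 1 ≤ d) (lam : ℝ) (hlam : 1 < lam)
    (ν : ℝ) (hν : ν = lam ^ ((1 : ℝ) / ((d : ℝ) + 1)))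
    (x m z : ℕ) (hzx : z ≤ x)
    (hx : ((x : ℝ) + 1) ^ (d + 1) ≤
      ν * ((x : ℝ) ^ (d + 1) - ((x : ℝ) + 1) ^ d + (x : ℝ) ^ d)) :
    lam * (∑ i ∈ Finset.Icc (z + 1) (m + z), (i : ℝ) ^ d)
        - (m : ℝ) * ν * ((x : ℝ) + 1) ^ d + ((x : ℝ) - (z : ℝ)) * ν * (x : ℝ) ^ d
      ≥ ∑ i ∈ Finset.Icc (z + 1) x, (i : ℝ) ^ d := by
  have hd0 : (0 : ℝ) < (d : ℝ) + 1 := by positivity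
  have hν1 : 1 < ν := by
    rw [hν]
    exact Real.one_lt_rpow hlam (by positivity)
  have hpow : ν ^ (d + 1) = lam := by
    rw [hν, ← Real.rpow_natCast, ← Real.rpow_mul (by linarith)]
    push_cast
    rw [one_div_mul_cancel hd0.ne', Real.rpow_one]
  have hνlam : ν ≤ lam := by
    rw [← hpow]
    exact le_self_pow₀ hν1.le (by omega)
  obtain ⟨n, rfl⟩ : ∃ n, x = n + z := ⟨x - z, by omega⟩
  rw [sum_Icc_eq, sum_Icc_eq]
  set x := n + z with hxdef
  set M := m + z with hMdef
  have hxc : (x : ℝ) = n + z := by rw [hxdef]; push_cast; ring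
  have hMc : (M : ℝ) = m + z := by rw [hMdef]; push_cast; ring
  set c : ℝ := ((x : ℝ) + 1) ^ d - (x : ℝ) ^ d with hc
  have hc0 : 0 ≤ c := by
    have : (x : ℝ) ^ d ≤ ((x : ℝ) + 1) ^ d := by
      gcongr
      linarith
    linarith
  -- the case z = 0
  have B0 : 0 ≤ lam * powSum d M - M * ν * ((x : ℝ) + 1) ^ d + ν * (x : ℝ) ^ (d + 1)
      - powSum d x := by
    have y := young d (ν * M) ((x : ℝ) + 1) (by positivity) (by positivity)
    rw [mul_pow, hpow] at y
    have l := mul_le_mul_of_nonneg_left (powSum_lower d M) (by linarith : 0 ≤ lam)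
    have u := powSum_upper d x
    have hνc : 0 ≤ ν * c := by positivity
    have hx' : ((x : ℝ) + 1) ^ (d + 1) ≤ ν * (x : ℝ) ^ (d + 1) := by
      rw [hc] at hνc
      linarith
    have hx2 := mul_le_mul_of_nonneg_left hx' hd0.le
    refine nonneg_of_mul_nonneg_right (a := (d : ℝ) + 1) ?_ hd0
    linarith
  -- the extreme case
  have key : ∀ k : ℕ, 0 ≤ lam * powSum d M - M * ν * ((x : ℝ) + 1) ^ d + ν * (x : ℝ) ^ (d + 1)
      - powSum d x + (((k : ℝ) + z) * ν * c - (lam - 1) * powSum d (k + z)) →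
      0 ≤ lam * powSum d M - M * ν * ((x : ℝ) + 1) ^ d + ν * (x : ℝ) ^ (d + 1)
      - powSum d x + ((z : ℝ) * ν * c - (lam - 1) * powSum d z) := by
    intro k hk
    generalize lam * powSum d M - M * ν * ((x : ℝ) + 1) ^ d + ν * (x : ℝ) ^ (d + 1)
      - powSum d x = B at *
    rcases Nat.eq_zero_or_pos z with h0 | hz
    · rw [h0, powSum_zero]
      simpa using B0
    have hzp : (0 : ℝ) < z := by exact_mod_cast hz
    have hkp : (0 : ℝ) ≤ k := Nat.cast_nonneg k
    refine nonneg_of_mul_nonneg_right (a := (k : ℝ) + z) ?_ (by positivity)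
    have a1 := mul_le_mul_of_nonneg_left (powSum_avg d z k) (by linarith : 0 ≤ lam - 1)
    have a2 := mul_nonneg hzp.le hk
    have a3 := mul_nonneg hkp B0
    linarith
  have fin : 0 ≤ lam * powSum d M - M * ν * ((x : ℝ) + 1) ^ d + ν * (x : ℝ) ^ (d + 1)
      - powSum d x + ((z : ℝ) * ν * c - (lam - 1) * powSum d z) := by
    rcases le_total x M with h | h
    · apply key n
      rw [← hxdef, ← hxc]
      obtain ⟨j, hj⟩ : ∃ j, M = j + x := ⟨M - x, by omega⟩
      have l := powSum_diff_lower d x j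
      rw [← hj] at l
      have hjc : (M : ℝ) = j + x := by rw [hj]; push_cast; ring
      have l1 := mul_le_mul_of_nonneg_left l (by linarith : 0 ≤ lam)
      have l2 := mul_le_mul_of_nonneg_right hνlam
        (by positivity : 0 ≤ (j : ℝ) * ((x : ℝ) + 1) ^ d)
      rw [hjc, hc, pow_succ]
      linarith
    · apply key m
      rw [← hMdef, ← hMc]
      obtain ⟨j, hj⟩ : ∃ j, x = j + M := ⟨x - M, by omega⟩
      have hjc : (x : ℝ) = j + M := by rw [hj]; push_cast; ring
      have l := powSum_diff_upper d M j
      rw [← hj, ← hjc] at l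
      have l2 := mul_le_mul_of_nonneg_right hν1.le
        (by positivity : 0 ≤ (j : ℝ) * (x : ℝ) ^ d)
      have e : (j : ℝ) = x - M := by linarith
      rw [e] at l l2
      rw [hc, pow_succ]
      linarith
  rw [hc, hMc, pow_succ] at fin
  linarith
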